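/- Let G = (V₁,E₁) be a connected graph with |V₁| ≥ 2 and H = (V₂,E₂) a κ-regular graph on n = |V₂| vertices (n ≥ 1, κ ≥ 0) with adjacency matrix A_H. Assume min ev(A_H) = −2. Then QEC(G⊙H) = (1/2)·[ (n+1)·QEC(G) − (κ+2) + √( ((n+1)·QEC(G) − (κ+2))² + 4(κ+2)·QEC(G) ) ] if QEC(G) > 0, and QEC(G⊙H) = 0 if QEC(G) ≤ 0. -/

import Mathlib

open scoped BigOperators
open Filter Topology
open scoped Classical

namespace QECPaper

/-- The cone (join) `K₁ + H` over a graph `H`: vertex `none` is the apex. -/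
def cone {V₂ : Type*} (H : SimpleGraph V₂) : SimpleGraph (Option V₂) where
  Adj x y := (∃ a b, x = some a ∧ y = some b ∧ H.Adj a b) ∨
    (x = none ∧ y ≠ none) ∨ (x ≠ none ∧ y = none)
  symm := by
    refine ⟨?_⟩
    rintro x y (⟨a, b, rfl, rfl, h⟩ | ⟨rfl, hy⟩ | ⟨hx, rfl⟩)
    · exact Or.inl ⟨b, a, rfl, rfl, h.symm⟩
    · exact Or.inr (Or.inr ⟨hy, rfl⟩)
    · exact Or.inr (Or.inl ⟨rfl, hx⟩)
  loopless := by
    refine ⟨?_⟩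
    rintro x (⟨a, b, rfl, hb, h⟩ | ⟨rfl, hy⟩ | ⟨hx, rfl⟩)
    · exact H.loopless.irrefl a (by cases hb; exact h)
    · exact hy rfl
    · exact hx rfl

/-- The corona `G ⊙ H` of two graphs, realized on `V₁ × ({o} ∪ V₂)`
with `o = none`. -/
def corona {V₁ V₂ : Type*} (G : SimpleGraph V₁) (H : SimpleGraph V₂) :
    SimpleGraph (V₁ × Option V₂) where
  Adj p q := (p.1 = q.1 ∧ (cone H).Adj p.2 q.2) ∨
    (G.Adj p.1 q.1 ∧ p.2 = none ∧ q.2 = none)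
  symm := by
    refine ⟨?_⟩
    rintro ⟨i, x⟩ ⟨j, y⟩ (⟨h1, h2⟩ | ⟨h1, h2, h3⟩)
    · exact Or.inl ⟨h1.symm, (cone H).adj_symm h2⟩
    · exact Or.inr ⟨h1.symm, h3, h2⟩
  loopless := by
    refine ⟨?_⟩
    rintro ⟨i, x⟩ (⟨h1, h2⟩ | ⟨h1, h2, h3⟩)
    · exact (cone H).loopless.irrefl x h2
    · exact G.loopless.irrefl i h1

/-- The quadratic embedding constant of a (connected) graph on a finite vertex set. -/
noncomputable def QEC {V : Type*} [Fintype V] (G : SimpleGraph V) : ℝ :=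
  sSup {r : ℝ | ∃ f : V → ℝ, (∑ x, f x ^ 2) = 1 ∧ (∑ x, f x) = 0 ∧
    r = ∑ x, ∑ y, f x * (G.dist x y : ℝ) * f y}

/-- The set `λ(S)` of `λ` appearing in a solution of the basic equations. -/
def lambdaS {V : Type*} [Fintype V] (G : SimpleGraph V) : Set ℝ :=
  {lam : ℝ | ∃ (f : V → ℝ) (μ : ℝ),
    (∀ x, (∑ y, (G.dist x y : ℝ) * f y) - lam * f x = μ / 2) ∧
    (∑ x, f x) = 0 ∧ (∑ x, f x ^ 2) = 1}

/-- The distance matrix of a graph, with real entries. -/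
noncomputable def distMatrix {V : Type*} (G : SimpleGraph V) : Matrix V V ℝ :=
  Matrix.of fun x y => (G.dist x y : ℝ)

section MatrixFunctions

variable {ι : Type*} [Fintype ι] [DecidableEq ι]

/-- The eigenspace `ker (A - α)` inside `EuclideanSpace ℝ ι`. -/
noncomputable def eigSpace (A : Matrix ι ι ℝ) (α : ℝ) :
    Submodule ℝ (EuclideanSpace ℝ ι) :=
  LinearMap.ker (Matrix.toEuclideanLin A - α • LinearMap.id)

/-- The all-ones vector of `EuclideanSpace ℝ ι`. -/
noncomputable def onesE (ι : Type*) [Fintype ι] : EuclideanSpace ℝ ι :=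
  (WithLp.equiv 2 (ι → ℝ)).symm (fun _ => 1)

/-- `‖E_α 𝟏‖²`, where `E_α` is the orthogonal projection of `EuclideanSpace ℝ ι`
onto the eigenspace `ker (A - α)`. -/
noncomputable def projNormSq (A : Matrix ι ι ℝ) (α : ℝ) : ℝ :=
  ‖(Submodule.orthogonalProjectionOnto (eigSpace A α) (onesE ι) : EuclideanSpace ℝ ι)‖ ^ 2

/-- The set of (real) eigenvalues of a matrix. -/
def evSet (A : Matrix ι ι ℝ) : Set ℝ :=
  {α : ℝ | ∃ v : ι → ℝ, v ≠ 0 ∧ A.mulVec v = α • v}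

/-- The set of main eigenvalues: those `α` with `E_α 𝟏 ≠ 0`. -/
def mainEv (A : Matrix ι ι ℝ) : Set ℝ := {α : ℝ | projNormSq A α ≠ 0}

/-- `k_A = |ev_M(A) \ {-2}|`. -/
noncomputable def kA (A : Matrix ι ι ℝ) : ℕ := (mainEv A \ {(-2 : ℝ)}).ncard

/-- The ω-function associated with the symmetric matrix `A`. -/
noncomputable def omegaFun (A : Matrix ι ι ℝ) (lam : ℝ) : ℝ :=
  1 + projNormSq A (-2) +
    ∑ᶠ α ∈ mainEv A \ {(-2 : ℝ)}, lam / (α + 2 + lam) * projNormSq A α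

/-- The (maximal) domain of the ω-function: the complement of its poles. -/
def omegaDomain (A : Matrix ι ι ℝ) : Set ℝ :=
  {lam : ℝ | ∀ α ∈ mainEv A \ {(-2 : ℝ)}, lam ≠ -α - 2}

/-- The set of zeroes of the ω-function (on its domain). -/
def omegaZeros (A : Matrix ι ι ℝ) : Set ℝ :=
  {lam : ℝ | lam ∈ omegaDomain A ∧ omegaFun A lam = 0}

/-- `λ*`, the largest zero of the ω-function. -/
noncomputable def lamStar (A : Matrix ι ι ℝ) : ℝ := sSup (omegaZeros A)

/-- The ψ-function associated with `A`: `ψ_A(λ) = λ/ω_A(λ)` extended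
analytically across the poles of `ω_A` by the value `0`. -/
noncomputable def psiFun (A : Matrix ι ι ℝ) (lam : ℝ) : ℝ :=
  if -lam - 2 ∈ mainEv A \ {(-2 : ℝ)} then 0 else lam / omegaFun A lam

/-- The inverse of the rightmost branch `ψ_{A*} = ψ_A ↾ (λ*, +∞)`:
`ψ_{A*}⁻¹(y)` is the unique `λ > λ*` with `ψ_A(λ) = y`. -/
noncomputable def psiStarInv (A : Matrix ι ι ℝ) (y : ℝ) : ℝ :=
  sSup {lam : ℝ | lamStar A < lam ∧ psiFun A lam = y}

end MatrixFunctions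

/-- A function which is `1`-Lipschitz along edges, vanishes on the diagonal and decreases along
some edge off the diagonal is the graph distance. -/
theorem dist_eq_of_lipschitz_of_descent {V : Type*} (G : SimpleGraph V) (D : V → V → ℕ)
    (hdiag : ∀ v, D v v = 0) (hlip : ∀ u v w, G.Adj u w → D u v ≤ D w v + 1)
    (hdesc : ∀ u v, u ≠ v → ∃ w, G.Adj u w ∧ D w v + 1 ≤ D u v) (u v : V) :
    G.dist u v = D u v := by
  have hlower : ∀ {a b : V} (p : G.Walk a b), D a b ≤ p.length := by
    intro a b p
    induction p with
    | nil => simp [hdiag]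
    | cons h p ih =>
      rw [SimpleGraph.Walk.length_cons]
      exact (hlip _ _ _ h).trans (by omega)
  have hupper : ∀ (n : ℕ) (a b : V), D a b ≤ n → ∃ p : G.Walk a b, p.length ≤ n := by
    intro n
    induction n with
    | zero =>
      intro a b hab
      by_cases h : a = b
      · subst h
        exact ⟨SimpleGraph.Walk.nil, le_rfl⟩
      · obtain ⟨w, -, hw⟩ := hdesc a b h
        omega
    | succ n ih =>
      intro a b hab
      by_cases h : a = b
      · subst h
        exact ⟨SimpleGraph.Walk.nil, Nat.zero_le _⟩
      · obtain ⟨w, hadj, hw⟩ := hdesc a b h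
        obtain ⟨p, hp⟩ := ih w b (by omega)
        exact ⟨SimpleGraph.Walk.cons hadj p, by rw [SimpleGraph.Walk.length_cons]; omega⟩
  obtain ⟨p, hp⟩ := hupper _ u v le_rfl
  obtain ⟨q, hq⟩ := p.reachable.exists_walk_length_eq_dist
  exact le_antisymm ((SimpleGraph.dist_le p).trans hp) (hq ▸ hlower q)

/-- The distance from the apex in a cone. -/
def coneHeight {V₂ : Type*} : Option V₂ → ℕ
  | none => 0
  | some _ => 1

/-- The distance between two vertices of a cone. -/
noncomputable def coneDist {V₂ : Type*} (H : SimpleGraph V₂) : Option V₂ → Option V₂ → ℕ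
  | none, y => coneHeight y
  | some _, none => 1
  | some a, some b => if a = b then 0 else if H.Adj a b then 1 else 2

theorem exists_adj_dist_add_one {V : Type*} {G : SimpleGraph V} (hG : G.Connected) {i j : V}
    (hij : i ≠ j) : ∃ k, G.Adj i k ∧ G.dist k j + 1 ≤ G.dist i j := by
  obtain ⟨p, hp⟩ := hG.exists_walk_length_eq_dist i j
  cases p with
  | nil => exact absurd rfl hij
  | cons h p =>
    refine ⟨_, h, ?_⟩
    rw [← hp, SimpleGraph.Walk.length_cons]
    exact Nat.add_le_add_right (SimpleGraph.dist_le p) 1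

theorem corona_dist {V₁ V₂ : Type*} {G : SimpleGraph V₁} (H : SimpleGraph V₂)
    (hG : G.Connected) (p q : V₁ × Option V₂) :
    (corona G H).dist p q = if p.1 = q.1 then coneDist H p.2 q.2
      else G.dist p.1 q.1 + coneHeight p.2 + coneHeight q.2 := by
  refine dist_eq_of_lipschitz_of_descent (corona G H) (fun p q => if p.1 = q.1
    then coneDist H p.2 q.2 else G.dist p.1 q.1 + coneHeight p.2 + coneHeight q.2) ?_ ?_ ?_ p q
  · rintro ⟨i, _ | a⟩ <;> simp [coneDist, coneHeight]
  · rintro ⟨i, x⟩ ⟨j, y⟩ ⟨k, z⟩ (⟨h, hxz⟩ | ⟨h, hx, hz⟩)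
    · dsimp only at h hxz ⊢
      subst h
      have hcone : coneDist H x y ≤ coneDist H z y + 1 := by
        obtain ⟨a, b, rfl, rfl, hab⟩ | ⟨rfl, hz⟩ | ⟨hx, rfl⟩ := hxz
        · rcases y with _ | c
          · simp [coneDist]
          · by_cases hbc : b = c
            · subst hbc
              simp only [coneDist, hab, if_true]
              split_ifs <;> omega
            · simp only [coneDist, hbc, if_false]
              split_ifs <;> omega
        · rcases y with _ | c <;> simp [coneDist, coneHeight]
        · rcases x with _ | a
          · exact absurd rfl hx
          · rcases y with _ | c
            · simp [coneDist]
            · simp only [coneDist, coneHeight]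
              split_ifs <;> omega
      have hheight : coneHeight x ≤ coneHeight z + 1 := by
        rcases x with _ | a <;> simp [coneHeight]
      split_ifs <;> omega
    · dsimp only at h hx hz ⊢
      subst hx hz
      have htri := hG.dist_triangle (u := i) (v := k) (w := j)
      rw [SimpleGraph.dist_eq_one_iff_adj.2 h] at htri
      by_cases hij : i = j
      · subst hij
        simp only [if_true, if_neg h.ne', coneDist, coneHeight]
        omega
      · by_cases hkj : k = j
        · subst hkj
          simp only [if_true, if_neg hij, coneDist, coneHeight,
            SimpleGraph.dist_eq_one_iff_adj.2 h]
          omega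
        · simp only [if_neg hij, if_neg hkj, coneHeight]
          omega
  · rintro ⟨i, x⟩ ⟨j, y⟩ hne
    by_cases hij : i = j
    · subst hij
      rcases x with _ | a <;> rcases y with _ | b
      · exact absurd rfl hne
      · exact ⟨(i, some b), Or.inl ⟨rfl, by simp [cone]⟩, by simp [coneDist, coneHeight]⟩
      · exact ⟨(i, none), Or.inl ⟨rfl, by simp [cone]⟩, by simp [coneDist, coneHeight]⟩
      · have hab : a ≠ b := fun h => hne (by rw [h])
        by_cases hadj : H.Adj a b
        · exact ⟨(i, some b), Or.inl ⟨rfl, by simp [cone, hadj]⟩, by simp [coneDist, hab, hadj]⟩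
        · exact ⟨(i, none), Or.inl ⟨rfl, by simp [cone]⟩,
            by simp [coneDist, coneHeight, hab, hadj]⟩
    · rcases x with _ | a
      · obtain ⟨k, hadj, hk⟩ := exists_adj_dist_add_one hG hij
        refine ⟨(k, none), Or.inr ⟨hadj, rfl, rfl⟩, ?_⟩
        by_cases hkj : k = j
        · subst hkj
          simp only [if_true, if_neg hij, coneDist, coneHeight]
          omega
        · simp only [if_neg hij, if_neg hkj, coneHeight]
          omega
      · refine ⟨(i, none), Or.inl ⟨rfl, by simp [cone]⟩, ?_⟩
        simp only [if_neg hij, coneHeight]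
        omega

/-- The set whose supremum is `QEC G` is bounded above. -/
theorem bddAbove_qec {V : Type*} [Fintype V] (G : SimpleGraph V) :
    BddAbove {r : ℝ | ∃ f : V → ℝ, (∑ x, f x ^ 2) = 1 ∧ (∑ x, f x) = 0 ∧
      r = ∑ x, ∑ y, f x * (G.dist x y : ℝ) * f y} := by
  refine ⟨∑ x, ∑ y, (G.dist x y : ℝ), ?_⟩
  rintro r ⟨f, hf, -, rfl⟩
  have hle : ∀ x, |f x| ≤ 1 := fun x => by
    rw [← sq_le_one_iff_abs_le_one, ← hf]
    exact Finset.single_le_sum (f := fun x => f x ^ 2) (fun _ _ => sq_nonneg _)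
      (Finset.mem_univ x)
  refine Finset.sum_le_sum fun x _ => Finset.sum_le_sum fun y _ => ?_
  have hxy : f x * f y ≤ 1 := by
    refine (le_abs_self _).trans ?_
    rw [abs_mul]
    exact mul_le_one₀ (hle x) (abs_nonneg _) (hle y)
  have hd : (0 : ℝ) ≤ G.dist x y := Nat.cast_nonneg _
  nlinarith

theorem sum_dist_le_qec_mul {V : Type*} [Fintype V] (G : SimpleGraph V) (f : V → ℝ)
    (hf : ∑ x, f x = 0) :
    ∑ x, ∑ y, f x * (G.dist x y : ℝ) * f y ≤ QEC G * ∑ x, f x ^ 2 := by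
  set N := ∑ x, f x ^ 2 with hN
  have hN0 : 0 ≤ N := Finset.sum_nonneg fun _ _ => sq_nonneg _
  obtain h0 | hpos := hN0.eq_or_lt
  · have hz : ∀ x, f x = 0 := fun x => by
      have := (Finset.sum_eq_zero_iff_of_nonneg (fun _ _ => sq_nonneg _)).1 (hN ▸ h0.symm) x
        (Finset.mem_univ x)
      exact pow_eq_zero_iff two_ne_zero |>.1 this
    simp [hz, ← h0]
  · have hs : (√N) ^ 2 = N := Real.sq_sqrt hN0
    have key : (∑ x, ∑ y, f x * (G.dist x y : ℝ) * f y) / N ≤ QEC G := by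
      refine le_csSup (bddAbove_qec G) ⟨fun x => f x / √N, ?_, ?_, ?_⟩
      · simp only [div_pow, hs]
        rw [← Finset.sum_div, ← hN, div_self hpos.ne']
      · rw [← Finset.sum_div, hf, zero_div]
      · simp only [Finset.sum_div]
        refine Finset.sum_congr rfl fun x _ => Finset.sum_congr rfl fun y _ => ?_
        rw [div_mul_eq_mul_div, div_mul_div_comm, ← pow_two, hs]
    rwa [div_le_iff₀ hpos] at key

/-- The quadratic form of `A + 2` on functions on the vertices of `H`. -/
noncomputable def shiftedForm {V₂ : Type*} [Fintype V₂] [DecidableEq V₂] (H : SimpleGraph V₂)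
    [DecidableRel H.Adj] (g : V₂ → ℝ) : ℝ :=
  ∑ a, ∑ b, g a * (if a = b then 2 else if H.Adj a b then 1 else 0) * g b

theorem corona_dist_cast {V₁ V₂ : Type*} [DecidableEq V₂] {G : SimpleGraph V₁}
    (H : SimpleGraph V₂) [DecidableRel H.Adj] (hG : G.Connected) (i j : V₁) (x y : Option V₂) :
    ((corona G H).dist (i, x) (j, y) : ℝ) = G.dist i j + coneHeight x + coneHeight y -
      if i = j then x.elim 0 (fun a => y.elim 0 (fun b =>
        if a = b then 2 else if H.Adj a b then 1 else 0)) else 0 := by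
  rw [corona_dist H hG]
  by_cases hij : i = j
  · subst hij
    rcases x with _ | a <;> rcases y with _ | b <;>
      simp only [if_true, coneDist, coneHeight, Option.elim, SimpleGraph.dist_self] <;>
      try norm_num
    by_cases hab : a = b
    · simp [hab]
    · by_cases hadj : H.Adj a b <;> norm_num [hab, hadj]
  · simp [hij]

theorem corona_form {V₁ V₂ : Type*} [Fintype V₁] [Fintype V₂] [DecidableEq V₂]
    {G : SimpleGraph V₁} (H : SimpleGraph V₂) [DecidableRel H.Adj] (hG : G.Connected)
    (f : V₁ × Option V₂ → ℝ) (hf : ∑ p, f p = 0) :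
    ∑ p, ∑ q, f p * ((corona G H).dist p q : ℝ) * f q =
      (∑ i, ∑ j, (∑ x, f (i, x)) * (G.dist i j : ℝ) * ∑ y, f (j, y)) -
        ∑ i, shiftedForm H fun a => f (i, some a) := by
  have hsplit : ∀ p q : V₁ × Option V₂, f p * ((corona G H).dist p q : ℝ) * f q =
      f p * (G.dist p.1 q.1 : ℝ) * f q + (f p * coneHeight p.2) * f q +
        f p * (coneHeight q.2 * f q) -
      (if p.1 = q.1 then p.2.elim 0 (fun a => q.2.elim 0 (fun b => f p *
        (if a = b then 2 else if H.Adj a b then 1 else 0) * f q)) else 0) := by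
    rintro ⟨i, x⟩ ⟨j, y⟩
    rw [corona_dist_cast H hG]
    by_cases hij : i = j <;> rcases x with _ | a <;> rcases y with _ | b <;>
      simp only [hij, if_true, if_false, Option.elim] <;> ring
  simp only [hsplit, Finset.sum_sub_distrib, Finset.sum_add_distrib, ← Finset.mul_sum,
    hf, mul_zero, add_zero]
  rw [← Finset.sum_mul, hf, zero_mul, add_zero]
  congr 1
  · simp only [Fintype.sum_prod_type, Finset.sum_mul, Finset.mul_sum]
    refine Finset.sum_congr rfl fun i _ => ?_
    rw [Finset.sum_comm]
    exact Finset.sum_congr rfl fun j _ => Finset.sum_comm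
  · simp only [Fintype.sum_prod_type, shiftedForm]
    refine Finset.sum_congr rfl fun i _ => ?_
    simp [Fintype.sum_option]

theorem sum_adjMatrix_mulVec {V₂ : Type*} [Fintype V₂] {H : SimpleGraph V₂} [DecidableRel H.Adj]
    {κ : ℕ} (hreg : H.IsRegularOfDegree κ) (g : V₂ → ℝ) :
    ∑ a, (H.adjMatrix ℝ).mulVec g a = κ * ∑ a, g a := by
  simp only [Matrix.mulVec, dotProduct]
  rw [Finset.sum_comm, Finset.mul_sum]
  refine Finset.sum_congr rfl fun b _ => ?_
  rw [← Finset.sum_mul]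
  congr 1
  simp only [SimpleGraph.adjMatrix_apply, H.adj_comm _ b]
  rw [Finset.sum_boole, ← hreg b, ← SimpleGraph.card_neighborFinset_eq_degree,
    SimpleGraph.neighborFinset_eq_filter]

/-- An eigenvector of a regular graph for the eigenvalue `-2` is orthogonal to the constants. -/
theorem sum_eq_zero_of_mulVec_eq_neg_two {V₂ : Type*} [Fintype V₂] {H : SimpleGraph V₂}
    [DecidableRel H.Adj]
    {κ : ℕ} (hreg : H.IsRegularOfDegree κ) {v : V₂ → ℝ}
    (hv : (H.adjMatrix ℝ).mulVec v = (-2 : ℝ) • v) : ∑ a, v a = 0 := by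
  have h1 := sum_adjMatrix_mulVec hreg v
  rw [hv] at h1
  simp only [Pi.smul_apply, smul_eq_mul, ← Finset.mul_sum] at h1
  have h2 : ((κ : ℝ) + 2) * ∑ a, v a = 0 := by linarith
  exact (mul_eq_zero.1 h2).resolve_left (by positivity)

section Shifted

variable {V₂ : Type*} [Fintype V₂] [DecidableEq V₂] (H : SimpleGraph V₂) [DecidableRel H.Adj]

theorem sum_shifted_mul (g : V₂ → ℝ) (a : V₂) :
    ∑ b, (if a = b then 2 else if H.Adj a b then 1 else 0) * g b =
      (H.adjMatrix ℝ).mulVec g a + 2 * g a := by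
  have : ∀ b, (if a = b then (2 : ℝ) else if H.Adj a b then 1 else 0) * g b =
      H.adjMatrix ℝ a b * g b + if a = b then 2 * g b else 0 := by
    intro b
    by_cases hab : a = b
    · subst hab; simp
    · simp [hab, SimpleGraph.adjMatrix_apply]
  simp only [this, Finset.sum_add_distrib, Finset.sum_ite_eq, Finset.mem_univ, if_true]
  rfl

theorem shiftedForm_eq (g : V₂ → ℝ) :
    shiftedForm H g = g ⬝ᵥ (H.adjMatrix ℝ).mulVec g + 2 * ∑ a, g a ^ 2 := by
  simp only [shiftedForm, mul_assoc, ← Finset.mul_sum, sum_shifted_mul, dotProduct]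
  rw [Finset.mul_sum, ← Finset.sum_add_distrib]
  exact Finset.sum_congr rfl fun a _ => by ring

theorem shiftedForm_nonneg (hmin : -2 ∈ lowerBounds (evSet (H.adjMatrix ℝ))) (g : V₂ → ℝ) :
    0 ≤ shiftedForm H g := by
  have hA : (H.adjMatrix ℝ).IsHermitian := by
    rw [Matrix.IsHermitian, Matrix.conjTranspose_eq_transpose_of_trivial]
    exact H.transpose_adjMatrix
  have hB : (H.adjMatrix ℝ + (2 : ℝ) • (1 : Matrix V₂ V₂ ℝ)).IsHermitian := by
    refine hA.add ?_
    simp [Matrix.IsHermitian]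
  have hpsd := hB.posSemidef_iff_eigenvalues_nonneg.2 fun i => by
    have hv := hB.mulVec_eigenvectorBasis i
    have hne : (hB.eigenvectorBasis i).ofLp ≠ 0 := fun h =>
      hB.eigenvectorBasis.orthonormal.ne_zero i (by ext x; exact congrFun h x)
    have : -2 ≤ hB.eigenvalues i - 2 := hmin ⟨_, hne, by
      rw [Matrix.add_mulVec, Matrix.smul_mulVec, Matrix.one_mulVec] at hv
      rw [sub_smul, ← hv, add_sub_cancel_right]⟩
    simp only [Pi.zero_apply]
    linarith
  have := hpsd.dotProduct_mulVec_nonneg g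
  rw [Matrix.add_mulVec, Matrix.smul_mulVec, Matrix.one_mulVec, dotProduct_add,
    dotProduct_smul] at this
  rw [shiftedForm_eq]
  simpa [dotProduct, pow_two] using this

variable {H}

theorem shiftedForm_const_add {κ : ℕ} (hreg : H.IsRegularOfDegree κ) (c : ℝ) (g : V₂ → ℝ)
    (hg : ∑ a, g a = 0) :
    shiftedForm H (fun a => c + g a) =
      Fintype.card V₂ * ((κ : ℝ) + 2) * c ^ 2 + shiftedForm H g := by
  have hc : (H.adjMatrix ℝ).mulVec (fun a => c + g a) =
      fun a => κ * c + (H.adjMatrix ℝ).mulVec g a := by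
    ext a
    have h1 := H.adjMatrix_mulVec_const_apply (α := ℝ) (a := c) (v := a)
    rw [hreg a] at h1
    rw [← h1]
    exact congrFun (Matrix.mulVec_add (H.adjMatrix ℝ) (Function.const V₂ c) g) a
  have hAg : ∑ a, (H.adjMatrix ℝ).mulVec g a = 0 := by
    rw [sum_adjMatrix_mulVec hreg, hg, mul_zero]
  rw [shiftedForm_eq, shiftedForm_eq, hc]
  have e1 : ∀ a, (c + g a) * (κ * c + (H.adjMatrix ℝ).mulVec g a) =
      κ * c ^ 2 + c * (H.adjMatrix ℝ).mulVec g a + κ * c * g a +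
        g a * (H.adjMatrix ℝ).mulVec g a := fun a => by ring
  have e2 : ∀ a, (c + g a) ^ 2 = c ^ 2 + 2 * c * g a + g a ^ 2 := fun a => by ring
  simp only [dotProduct, e1, e2, Finset.sum_add_distrib, ← Finset.mul_sum, hAg, hg,
    Finset.sum_const, Finset.card_univ, nsmul_eq_mul]
  ring

theorem shiftedForm_const {κ : ℕ} (hreg : H.IsRegularOfDegree κ) (c : ℝ) :
    shiftedForm H (fun _ => c) = Fintype.card V₂ * ((κ : ℝ) + 2) * c ^ 2 := by
  have h := shiftedForm_const_add hreg c (fun _ => 0) (by simp)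
  simpa [shiftedForm] using h

theorem shiftedForm_ge (hmin : -2 ∈ lowerBounds (evSet (H.adjMatrix ℝ))) {κ : ℕ}
    (hreg : H.IsRegularOfDegree κ) (hV₂ : 1 ≤ Fintype.card V₂) (g : V₂ → ℝ) :
    ((κ : ℝ) + 2) * (∑ a, g a) ^ 2 / Fintype.card V₂ ≤ shiftedForm H g := by
  have hn : (0 : ℝ) < Fintype.card V₂ := by exact_mod_cast hV₂
  set c := (∑ a, g a) / Fintype.card V₂ with hc
  have h := shiftedForm_const_add hreg c (fun a => g a - c) (by
    rw [Finset.sum_sub_distrib, Finset.sum_const, Finset.card_univ, nsmul_eq_mul, hc]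
    field_simp
    ring)
  simp only [add_sub_cancel] at h
  have h0 := shiftedForm_nonneg H hmin fun a => g a - c
  have e : ((κ : ℝ) + 2) * (∑ a, g a) ^ 2 / Fintype.card V₂ =
      Fintype.card V₂ * ((κ : ℝ) + 2) * c ^ 2 := by
    rw [hc]
    field_simp
  linarith

end Shifted

/-- The `2 × 2` quadratic form inequality behind the corona formula. -/
theorem binary_form_le {n k Q lam a s : ℝ} (hn : 0 < n) (hQlam : Q < lam)
    (hlam : lam ^ 2 - ((n + 1) * Q - k) * lam - k * Q = 0) :
    Q * (a + s) ^ 2 - k * s ^ 2 / n ≤ lam * (a ^ 2 + s ^ 2 / n) := by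
  have h0 : 0 < lam - Q := sub_pos.2 hQlam
  have key : (lam - Q) * n * (lam * (a ^ 2 + s ^ 2 / n) - (Q * (a + s) ^ 2 - k * s ^ 2 / n)) =
      n * ((lam - Q) * a - Q * s) ^ 2 := by
    field_simp
    linear_combination s ^ 2 * hlam
  have h1 : 0 ≤ n * ((lam - Q) * a - Q * s) ^ 2 := by positivity
  rw [← key] at h1
  have h2 := nonneg_of_mul_nonneg_right h1 (mul_pos h0 hn)
  linarith

section Main

variable {V₁ V₂ : Type*} [Fintype V₁] [Fintype V₂] [DecidableEq V₂]
  {G : SimpleGraph V₁} {H : SimpleGraph V₂} [DecidableRel H.Adj]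

/-- The value `0` is attained by the quadratic form of the corona. -/
theorem zero_mem_qec_corona [Nonempty V₁] (hG : G.Connected) {κ : ℕ}
    (hreg : H.IsRegularOfDegree κ) (hmem : -2 ∈ evSet (H.adjMatrix ℝ)) :
    ∃ f : V₁ × Option V₂ → ℝ, (∑ x, f x ^ 2) = 1 ∧ (∑ x, f x) = 0 ∧
      (0 : ℝ) = ∑ x, ∑ y, f x * ((corona G H).dist x y : ℝ) * f y := by
  obtain ⟨v, hv0, hv⟩ := hmem
  obtain ⟨i₀⟩ := ‹Nonempty V₁›
  have hsum := sum_eq_zero_of_mulVec_eq_neg_two hreg hv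
  set N := ∑ a, v a ^ 2 with hN
  have hpos : 0 < N := by
    obtain ⟨a, ha⟩ := Function.ne_iff.1 hv0
    exact Finset.sum_pos' (fun _ _ => sq_nonneg _)
      ⟨a, Finset.mem_univ a, sq_pos_of_ne_zero ha⟩
  have hs : (√N) ^ 2 = N := Real.sq_sqrt hpos.le
  have hform : shiftedForm H (fun a => v a / √N) = 0 := by
    have e : (fun a => v a / √N) = (√N)⁻¹ • v := by
      ext a
      simp [div_eq_inv_mul]
    rw [shiftedForm_eq, e, Matrix.mulVec_smul, hv]
    simp only [dotProduct, Pi.smul_apply, smul_eq_mul, Finset.mul_sum]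
    rw [← Finset.sum_add_distrib]
    exact Finset.sum_eq_zero fun a _ => by ring
  set f : V₁ × Option V₂ → ℝ :=
    fun p => if p.1 = i₀ then p.2.elim 0 (fun a => v a / √N) else 0 with hf
  have hF : ∀ i, ∑ x, f (i, x) = 0 := fun i => by
    by_cases h : i = i₀
    · simp [hf, h, Fintype.sum_option, ← Finset.sum_div, hsum]
    · simp [hf, h]
  have hf0 : ∑ p, f p = 0 := by
    rw [Fintype.sum_prod_type]
    exact Finset.sum_eq_zero fun i _ => hF i
  refine ⟨f, ?_, hf0, ?_⟩
  · rw [Fintype.sum_prod_type, Finset.sum_eq_single i₀]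
    · simp only [hf, Fintype.sum_option, if_true, Option.elim, div_pow, hs]
      rw [← Finset.sum_div, ← hN, div_self hpos.ne']
      norm_num
    · intro i _ hi
      simp [hf, hi]
    · simp
  · rw [corona_form H hG f hf0]
    simp only [hF, zero_mul, Finset.sum_const_zero, zero_sub]
    rw [Finset.sum_eq_zero, neg_zero]
    intro i _
    by_cases h : i = i₀
    · simpa [hf, h] using hform
    · simp [hf, h, shiftedForm]

/-- An upper bound on `QEC (G ⊙ H)` from a pointwise bound on each fibre. -/
theorem qec_corona_le [Nonempty V₁] (hG : G.Connected) (hV₂ : 1 ≤ Fintype.card V₂) {κ : ℕ}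
    (hreg : H.IsRegularOfDegree κ) (hmin : IsLeast (evSet (H.adjMatrix ℝ)) (-2)) {lam : ℝ}
    (hlam : 0 ≤ lam)
    (hbound : ∀ a s : ℝ, QEC G * (a + s) ^ 2 - ((κ : ℝ) + 2) * s ^ 2 / Fintype.card V₂ ≤
      lam * (a ^ 2 + s ^ 2 / Fintype.card V₂)) :
    QEC (corona G H) ≤ lam := by
  have hn : (0 : ℝ) < Fintype.card V₂ := by exact_mod_cast hV₂
  refine csSup_le ⟨0, zero_mem_qec_corona hG hreg hmin.1⟩ ?_
  rintro r ⟨f, hf1, hf0, rfl⟩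
  rw [corona_form H hG f hf0]
  rw [Fintype.sum_prod_type] at hf0 hf1
  have h1 := sum_dist_le_qec_mul G (fun i => ∑ x, f (i, x)) hf0
  have h2 : QEC G * ∑ i, (∑ x, f (i, x)) ^ 2 - ∑ i, shiftedForm H (fun a => f (i, some a)) ≤
      lam * ∑ i, ∑ x, f (i, x) ^ 2 := by
    rw [Finset.mul_sum, Finset.mul_sum, ← Finset.sum_sub_distrib]
    refine Finset.sum_le_sum fun i _ => ?_
    rw [Fintype.sum_option, Fintype.sum_option]
    have h3 := hbound (f (i, none)) (∑ a, f (i, some a))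
    have h4 := shiftedForm_ge hmin.2 hreg hV₂ fun a => f (i, some a)
    have h5 : (∑ a, f (i, some a)) ^ 2 / Fintype.card V₂ ≤ ∑ a, f (i, some a) ^ 2 := by
      rw [div_le_iff₀ hn, mul_comm]
      exact sq_sum_le_card_mul_sum_sq
    have h6 := mul_le_mul_of_nonneg_left h5 hlam
    linarith
  rw [hf1, mul_one] at h2
  exact (sub_le_sub_right h1 _).trans h2

/-- Lower bound on `QEC (G ⊙ H)` by test functions which are constant on each copy of `H`. -/
theorem le_qec_corona (hG : G.Connected) {κ : ℕ} (hreg : H.IsRegularOfDegree κ)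
    (hV₁ : 2 ≤ Fintype.card V₁) {a b : ℝ} (hnorm : a ^ 2 + Fintype.card V₂ * b ^ 2 = 1)
    (hab : a + Fintype.card V₂ * b ≠ 0) :
    QEC G * (a + Fintype.card V₂ * b) ^ 2 - Fintype.card V₂ * ((κ : ℝ) + 2) * b ^ 2 ≤
      QEC (corona G H) := by
  have hc : 0 < (a + Fintype.card V₂ * b) ^ 2 := by positivity
  rw [sub_le_iff_le_add, ← le_div_iff₀ hc]
  refine csSup_le ?_ ?_
  · obtain ⟨i, j, hij⟩ := Fintype.one_lt_card_iff.1 (by omega : 1 < Fintype.card V₁)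
    have hs : (√2 : ℝ) ^ 2 = 2 := Real.sq_sqrt (by norm_num)
    refine ⟨_, fun k => ((if k = i then 1 else 0) - (if k = j then 1 else 0)) / √2, ?_, ?_, rfl⟩
    · have e : ∀ k, (((if k = i then 1 else 0) - (if k = j then 1 else 0)) / √2 : ℝ) ^ 2 =
          ((if k = i then 1 else 0) + (if k = j then 1 else 0)) / 2 := fun k => by
        rw [div_pow, hs]
        by_cases hi : k = i
        · subst hi
          simp [hij]
        · by_cases hj : k = j <;> simp [hi, hj, hij.symm]
      simp only [e, ← Finset.sum_div, Finset.sum_add_distrib]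
      simp
    · rw [← Finset.sum_div]
      simp
  · rintro r ⟨g, hg1, hg0, rfl⟩
    rw [le_div_iff₀ hc, ← sub_le_iff_le_add]
    set f : V₁ × Option V₂ → ℝ := fun p => p.2.elim a (fun _ => b) * g p.1 with hf
    have hF : ∀ i, ∑ x, f (i, x) = (a + Fintype.card V₂ * b) * g i := fun i => by
      simp only [hf, Fintype.sum_option, Option.elim, Finset.sum_const, Finset.card_univ,
        nsmul_eq_mul]
      ring
    have hf0 : ∑ p, f p = 0 := by
      simp only [Fintype.sum_prod_type, hF, ← Finset.mul_sum, hg0, mul_zero]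
    refine le_csSup (bddAbove_qec _) ⟨f, ?_, hf0, ?_⟩
    · have e : ∀ i, ∑ x, f (i, x) ^ 2 = g i ^ 2 := fun i => by
        simp only [hf, Fintype.sum_option, Option.elim, Finset.sum_const, Finset.card_univ,
          nsmul_eq_mul]
        linear_combination g i ^ 2 * hnorm
      simp only [Fintype.sum_prod_type, e, hg1]
    · rw [corona_form H hG f hf0]
      have e : ∀ i, shiftedForm H (fun a => f (i, some a)) =
          Fintype.card V₂ * ((κ : ℝ) + 2) * b ^ 2 * g i ^ 2 := fun i => by
        refine (shiftedForm_const hreg (b * g i)).trans ?_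
        ring
      simp only [hF, e, ← Finset.mul_sum, hg1, mul_one, Finset.sum_mul]
      congr 1
      refine Finset.sum_congr rfl fun i _ => Finset.sum_congr rfl fun j _ => ?_
      ring

end Main

/-- `QEC(G⊙H)` for a `κ`-regular graph `H` with `min ev(A_H) = −2`. -/
theorem qec_corona_regular_minEv_eq_neg_two {V₁ V₂ : Type*} [Fintype V₁] [Fintype V₂]
    [DecidableEq V₂]
    (G : SimpleGraph V₁) (H : SimpleGraph V₂) [DecidableRel H.Adj]
    (hG : G.Connected) (hV₁ : 2 ≤ Fintype.card V₁) (hV₂ : 1 ≤ Fintype.card V₂)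
    (κ : ℕ) (hreg : H.IsRegularOfDegree κ)
    (hmin : IsLeast (evSet (H.adjMatrix ℝ)) (-2)) :
    (0 < QEC G → QEC (corona G H) =
      (((Fintype.card V₂ : ℝ) + 1) * QEC G - ((κ : ℝ) + 2) +
        Real.sqrt ((((Fintype.card V₂ : ℝ) + 1) * QEC G - ((κ : ℝ) + 2)) ^ 2 +
          4 * ((κ : ℝ) + 2) * QEC G)) / 2) ∧
    (QEC G ≤ 0 → QEC (corona G H) = 0) := by
  have hne : Nonempty V₁ := hG.nonempty
  have hn : (0 : ℝ) < Fintype.card V₂ := by exact_mod_cast hV₂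
  have hk : (0 : ℝ) < (κ : ℝ) + 2 := by positivity
  constructor
  · intro hQ
    set n : ℝ := (Fintype.card V₂ : ℝ) with hn_def
    set k : ℝ := (κ : ℝ) + 2 with hk_def
    set Q := QEC G with hQ_def
    set S := √(((n + 1) * Q - k) ^ 2 + 4 * k * Q) with hS
    set lam := ((n + 1) * Q - k + S) / 2 with hlam_def
    have hS2 : S ^ 2 = ((n + 1) * Q - k) ^ 2 + 4 * k * Q := Real.sq_sqrt (by positivity)
    have hlam : lam ^ 2 - ((n + 1) * Q - k) * lam - k * Q = 0 := by
      rw [hlam_def]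
      linear_combination hS2 / 4
    have hQlam : Q < lam := by
      have hlt : 2 * Q - ((n + 1) * Q - k) < S := by
        refine lt_of_pow_lt_pow_left₀ 2 (Real.sqrt_nonneg _) ?_
        rw [hS2]
        nlinarith [mul_pos hn (mul_pos hQ hQ)]
      rw [hlam_def]
      linarith
    refine le_antisymm ?_ ?_
    · exact qec_corona_le hG hV₂ hreg hmin (hQ.trans hQlam).le
        fun a s => binary_form_le hn hQlam hlam
    · have hd : 0 < lam - Q := sub_pos.2 hQlam
      set R := (Q * n) ^ 2 + n * (lam - Q) ^ 2 with hR
      have hRpos : 0 < R := by positivity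
      have hsR : (√R) ^ 2 = R := Real.sq_sqrt hRpos.le
      have hsR0 : 0 < √R := Real.sqrt_pos.2 hRpos
      have hnorm : (Q * n / √R) ^ 2 + n * ((lam - Q) / √R) ^ 2 = 1 := by
        rw [div_pow, div_pow, hsR]
        field_simp
        rw [hR]
        ring
      have hle := le_qec_corona hG hreg hV₁ hnorm (by positivity)
      refine le_of_eq_of_le ?_ hle
      have e : Q * (Q * n / √R + n * ((lam - Q) / √R)) ^ 2 - n * k * ((lam - Q) / √R) ^ 2 =
          (Q * (Q * n + n * (lam - Q)) ^ 2 - n * k * (lam - Q) ^ 2) / (√R) ^ 2 := by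
        field_simp
      rw [e, hsR, eq_div_iff hRpos.ne', hR]
      linear_combination n * (lam - Q) * hlam
  · intro hQ
    refine le_antisymm ?_ ?_
    · refine qec_corona_le hG hV₂ hreg hmin le_rfl fun a s => ?_
      have h1 : QEC G * (a + s) ^ 2 ≤ 0 := mul_nonpos_of_nonpos_of_nonneg hQ (sq_nonneg _)
      have h2 : 0 ≤ ((κ : ℝ) + 2) * s ^ 2 / Fintype.card V₂ := by positivity
      linarith
    · exact le_csSup (bddAbove_qec _) (zero_mem_qec_corona hG hreg hmin.1)

end QECPaper
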